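/- If (S,F,μ) is an orthogonal CP-measure space with barycenter T (meaning μ(Δ) ⊥ μ(Δᶜ) for all Δ ∈ F, where orthogonality means that the corresponding operators in the Radon–Nikodym correspondence are complementary projections), then κ_μ is a *-homomorphism: κ_μ(fg) = κ_μ(f)κ_μ(g) for all f, g ∈ L^∞(ν). -/

import Mathlib

open scoped ComplexOrder InnerProductSpace

noncomputable section

/-- A matrix over a star ring is positive if it is of the form `Nᴴ * N`. -/
def MatPos {A : Type*} [Ring A] [StarRing A] {n : ℕ}
    (M : Matrix (Fin n) (Fin n) A) : Prop :=
  ∃ N : Matrix (Fin n) (Fin n) A, M = N.conjTranspose * N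

/-- `T` is completely positive if the induced entrywise maps on matrices are positive. -/
def CompletelyPositiveFun {A B : Type*} [Ring A] [StarRing A] [Ring B] [StarRing B]
    (T : A → B) : Prop :=
  ∀ (n : ℕ) (M : Matrix (Fin n) (Fin n) A), MatPos M → MatPos (M.map T)

/-- `(π, K, V)` is a Stinespring representation of `T : X → B(H)`:
`T x = V* (π x) V` for all `x`. -/
def IsStinespring {X : Type*} [NormedRing X] [StarRing X] [CStarRing X]
    [NormedAlgebra ℂ X] [StarModule ℂ X]
    {H K : Type*} [NormedAddCommGroup H] [InnerProductSpace ℂ H] [CompleteSpace H]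
    [NormedAddCommGroup K] [InnerProductSpace ℂ K] [CompleteSpace K]
    (T : X → (H →L[ℂ] H)) (π : X →⋆ₐ[ℂ] (K →L[ℂ] K)) (V : H →L[ℂ] K) : Prop :=
  ∀ x : X, T x = (ContinuousLinearMap.adjoint V).comp ((π x).comp V)

/-- Minimality: the closed linear span of `π(X) V H` is all of `K`. -/
def IsMinimalStinespring {X : Type*} [NormedRing X] [StarRing X] [CStarRing X]
    [NormedAlgebra ℂ X] [StarModule ℂ X]
    {H K : Type*} [NormedAddCommGroup H] [InnerProductSpace ℂ H] [CompleteSpace H]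
    [NormedAddCommGroup K] [InnerProductSpace ℂ K] [CompleteSpace K]
    (π : X →⋆ₐ[ℂ] (K →L[ℂ] K)) (V : H →L[ℂ] K) : Prop :=
  (Submodule.span ℂ {k : K | ∃ (x : X) (h : H), k = π x (V h)}).topologicalClosure = ⊤

open MeasureTheory

section CPMeasure

variable {X : Type*} [NormedRing X] [StarRing X] [CStarRing X]
  [NormedAlgebra ℂ X] [StarModule ℂ X]
variable {H K : Type*} [NormedAddCommGroup H] [InnerProductSpace ℂ H] [CompleteSpace H]
  [NormedAddCommGroup K] [InnerProductSpace ℂ K] [CompleteSpace K]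
variable {S : Type*} [MeasurableSpace S]

/-- `μ` is a CP-measure on `(S, F)` with values in the von Neumann algebra `M`:
each `μ(Δ)` is a CP map from `X` into `M`, and `μ` is countably additive in the weak
sense (against all vector functionals, hence against all normal functionals). -/
def IsCPMeasure (M : VonNeumannAlgebra H) (μ : Set S → X → (H →L[ℂ] H)) : Prop :=
  (∀ Δ : Set S, MeasurableSet Δ →
      IsLinearMap ℂ (μ Δ) ∧ CompletelyPositiveFun (μ Δ) ∧ ∀ x : X, μ Δ x ∈ M) ∧
  (∀ Δ : ℕ → Set S, (∀ i, MeasurableSet (Δ i)) → Pairwise (Function.onFun Disjoint Δ) →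
    ∀ (x : X) (ξ η : H), ⟪ξ, μ (⋃ i, Δ i) x η⟫_ℂ = ∑' i, ⟪ξ, μ (Δ i) x η⟫_ℂ)

/-- The sequence `e` with `∑ ‖e n‖² = 1` determines the normal state
`ρ(A) = ∑ₙ ⟨e n, A (e n)⟩` on `B(H)`; faithfulness on `M` is required. -/
def IsNormalFaithfulStateOn (M : VonNeumannAlgebra H) (e : ℕ → H) : Prop :=
  (∑' n, (‖e n‖ : ℝ) ^ 2 = 1) ∧
  ∀ A : H →L[ℂ] H, A ∈ M → A.IsPositive → (∑' n, ⟪e n, A (e n)⟫_ℂ) = 0 → A = 0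

/-- `ν` is equivalent (mutually absolutely continuous) to the scalar measure
`ρ ∘ μ : Δ ↦ ∑ₙ ⟨e n, μ(Δ)(1) (e n)⟩`. -/
def IsEquivalentBaseMeasure (μ : Set S → X → (H →L[ℂ] H)) (e : ℕ → H)
    (ν : Measure S) : Prop :=
  ∀ Δ : Set S, MeasurableSet Δ → (ν Δ = 0 ↔ (∑' n, ⟪e n, μ Δ 1 (e n)⟫_ℂ) = 0)

/-- `R` satisfies the defining property of `κ_μ(f)`: for every vector functional
`⟨ξ, · η⟩`, every `x ∈ X`, and every `ν`-density `g` of the complex measure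
`Δ ↦ ⟨ξ, μ(Δ)(x) η⟩`, one has `⟨ξ, (V* R π(x) V) η⟩ = ∫ f g dν`, i.e. weakly
`V* R π(x) V = ∫ f(s) dμ(s, x)`. -/
def IsKappa (μ : Set S → X → (H →L[ℂ] H)) (ν : Measure S)
    (π : X →⋆ₐ[ℂ] (K →L[ℂ] K)) (V : H →L[ℂ] K) (f : S → ℂ) (R : K →L[ℂ] K) : Prop :=
  ∀ (x : X) (ξ η : H) (g : S → ℂ), Integrable g ν →
    (∀ Δ : Set S, MeasurableSet Δ → ⟪ξ, μ Δ x η⟫_ℂ = ∫ s in Δ, g s ∂ν) →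
    ⟪ξ, ((ContinuousLinearMap.adjoint V).comp (R.comp ((π x).comp V))) η⟫_ℂ
      = ∫ s, f s * g s ∂ν

end CPMeasure

section

open Set

/-- A bounded measurable complex-valued function. -/
def IsBoundedMeasurable {S : Type*} [MeasurableSpace S] (f : S → ℂ) : Prop :=
  Measurable f ∧ ∃ C : ℝ, ∀ s, ‖f s‖ ≤ C

section BoundedMeasurable

variable {S : Type*} [MeasurableSpace S] {f g : S → ℂ}

lemma IsBoundedMeasurable.add (hf : IsBoundedMeasurable f) (hg : IsBoundedMeasurable g) :
    IsBoundedMeasurable (fun s => f s + g s) := by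
  obtain ⟨hf, C, hC⟩ := hf
  obtain ⟨hg, D, hD⟩ := hg
  exact ⟨hf.add hg, C + D, fun s => (norm_add_le _ _).trans (add_le_add (hC s) (hD s))⟩

lemma IsBoundedMeasurable.sub (hf : IsBoundedMeasurable f) (hg : IsBoundedMeasurable g) :
    IsBoundedMeasurable (fun s => f s - g s) := by
  obtain ⟨hf, C, hC⟩ := hf
  obtain ⟨hg, D, hD⟩ := hg
  exact ⟨hf.sub hg, C + D, fun s => (norm_sub_le _ _).trans (add_le_add (hC s) (hD s))⟩

lemma IsBoundedMeasurable.mul (hf : IsBoundedMeasurable f) (hg : IsBoundedMeasurable g) :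
    IsBoundedMeasurable (fun s => f s * g s) := by
  obtain ⟨hf, C, hC⟩ := hf
  obtain ⟨hg, D, hD⟩ := hg
  refine ⟨hf.mul hg, C * D, fun s => ?_⟩
  rw [norm_mul]
  exact mul_le_mul (hC s) (hD s) (norm_nonneg _) ((norm_nonneg _).trans (hC s))

lemma IsBoundedMeasurable.star (hf : IsBoundedMeasurable f) :
    IsBoundedMeasurable (fun s => star (f s)) := by
  obtain ⟨hf, C, hC⟩ := hf
  exact ⟨continuous_star.measurable.comp hf, C, fun s => by simpa using hC s⟩

lemma isBoundedMeasurable_indicator {Δ : Set S} (hΔ : MeasurableSet Δ) (c : ℂ) :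
    IsBoundedMeasurable (Δ.indicator fun _ => c) :=
  ⟨measurable_const.indicator hΔ, ‖c‖, fun s => norm_indicator_le_norm_self (fun _ => c) s⟩

lemma SimpleFunc.isBoundedMeasurable (φ : SimpleFunc S ℂ) : IsBoundedMeasurable φ :=
  ⟨φ.measurable, φ.exists_forall_norm_le⟩

lemma IsBoundedMeasurable.integrable_mul {ν : Measure S} (hf : IsBoundedMeasurable f)
    (hg : Integrable g ν) : Integrable (fun s => f s * g s) ν := by
  obtain ⟨hf, C, hC⟩ := hf
  exact hg.bdd_mul hf.aestronglyMeasurable (Filter.Eventually.of_forall hC)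

/-- Bounded measurable functions are uniform limits of simple functions. -/
lemma IsBoundedMeasurable.exists_simpleFunc (hf : IsBoundedMeasurable f) {ε : ℝ} (hε : 0 < ε) :
    ∃ φ : SimpleFunc S ℂ, ∀ s, ‖f s - φ s‖ ≤ ε := by
  obtain ⟨hf, C, hC⟩ := hf
  set e := TopologicalSpace.denseSeq ℂ
  have hcover : Metric.closedBall (0 : ℂ) C ⊆ ⋃ i, Metric.ball (e i) ε := fun z _ => by
    obtain ⟨i, hi⟩ := (TopologicalSpace.denseRange_denseSeq ℂ).exists_dist_lt z hε
    exact mem_iUnion.2 ⟨i, hi⟩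
  obtain ⟨t, ht⟩ := (isCompact_closedBall (0 : ℂ) C).elim_finite_subcover _
    (fun i => Metric.isOpen_ball) hcover
  refine ⟨(SimpleFunc.nearestPt e (t.sup id)).comp f hf, fun s => ?_⟩
  have hs : f s ∈ Metric.closedBall (0 : ℂ) C := by simpa using hC s
  obtain ⟨i, hi, hsi⟩ := mem_iUnion₂.1 (ht hs)
  have h := SimpleFunc.edist_nearestPt_le e (f s) (Finset.le_sup (f := id) hi)
  rw [edist_dist, edist_dist, ENNReal.ofReal_le_ofReal_iff dist_nonneg] at h
  rw [← dist_eq_norm, dist_comm]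
  exact h.trans (by rw [dist_comm]; exact (Metric.mem_ball.1 hsi).le)

/-- A property of bounded measurable functions holds for all of them if it holds for multiples
of indicators and is stable under sums and uniform limits. -/
lemma IsBoundedMeasurable.induction {p : (S → ℂ) → Prop}
    (indicator : ∀ (c : ℂ) (Δ : Set S), MeasurableSet Δ → p (Δ.indicator fun _ => c))
    (add : ∀ f g, IsBoundedMeasurable f → IsBoundedMeasurable g → p f → p g →
      p (fun s => f s + g s))
    (lim : ∀ f, IsBoundedMeasurable f →
      (∀ ε > 0, ∃ g, IsBoundedMeasurable g ∧ p g ∧ ∀ s, ‖f s - g s‖ ≤ ε) → p f)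
    (hf : IsBoundedMeasurable f) : p f := by
  have hsimple : ∀ φ : SimpleFunc S ℂ, p φ := fun φ => by
    induction φ using SimpleFunc.induction with
    | const c hs =>
      convert indicator c _ hs using 1
      ext s
      simp [Set.indicator, Set.piecewise]
    | @add φ ψ _ hφ hψ =>
      exact add _ _ (SimpleFunc.isBoundedMeasurable φ) (SimpleFunc.isBoundedMeasurable ψ) hφ hψ
  refine lim f hf fun ε hε => ?_
  obtain ⟨φ, hφ⟩ := hf.exists_simpleFunc hε
  exact ⟨φ, SimpleFunc.isBoundedMeasurable φ, hsimple φ, hφ⟩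

end BoundedMeasurable

/-- Radon–Nikodym for complex measures dominated by a finite measure. -/
lemma exists_density_of_absolutelyContinuous {S : Type*} [MeasurableSpace S] (ν : Measure S)
    [IsFiniteMeasure ν] (c : ComplexMeasure S)
    (hc : ∀ Δ, MeasurableSet Δ → ν Δ = 0 → c Δ = 0) :
    ∃ g : S → ℂ, Integrable g ν ∧ ∀ Δ, MeasurableSet Δ → c Δ = ∫ s in Δ, g s ∂ν := by
  have hac : VectorMeasure.AbsolutelyContinuous c ν.toENNRealVectorMeasure :=
    VectorMeasure.AbsolutelyContinuous.mk fun Δ hΔ h => by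
      rw [Measure.toENNRealVectorMeasure_apply_measurable hΔ] at h
      exact hc Δ hΔ h
  obtain ⟨hre, him⟩ := (ComplexMeasure.absolutelyContinuous_ennreal_iff c _).1 hac
  rw [SignedMeasure.absolutelyContinuous_iff_withDensityᵥ_rnDeriv_eq] at hre him
  refine ⟨c.rnDeriv ν, c.integrable_rnDeriv ν, fun Δ hΔ => ?_⟩
  have hint := (c.integrable_rnDeriv ν).integrableOn (s := Δ)
  apply Complex.ext
  · have h : (c Δ).re = c.re Δ := rfl
    rw [h, ← RCLike.re_eq_complex_re, ← integral_re hint, ← hre,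
      withDensityᵥ_apply (SignedMeasure.integrable_rnDeriv _ _) hΔ]
    rfl
  · have h : (c Δ).im = c.im Δ := rfl
    rw [h, ← RCLike.im_eq_complex_im, ← integral_im hint, ← him,
      withDensityᵥ_apply (SignedMeasure.integrable_rnDeriv _ _) hΔ]
    rfl

section Operators

variable {K : Type*} [NormedAddCommGroup K] [InnerProductSpace ℂ K]

/-- The norm of an operator is at most twice any bound on its numerical radius. -/
lemma opNorm_le_of_numericalRadius_le (A : K →L[ℂ] K) {C : ℝ} (hC : 0 ≤ C)
    (hA : ∀ v, ‖⟪v, A v⟫_ℂ‖ ≤ C * ‖v‖ ^ 2) : ‖A‖ ≤ 2 * C := by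
  have hA' : ∀ v, ‖⟪A v, v⟫_ℂ‖ ≤ C * ‖v‖ ^ 2 := fun v => by
    rw [norm_inner_symm]; exact hA v
  have hpol : ∀ x y : K, ‖⟪A y, x⟫_ℂ‖ ≤ C * (‖x‖ ^ 2 + ‖y‖ ^ 2) := fun x y => by
    have h := inner_map_polarization (A : K →ₗ[ℂ] K) x y
    simp only [ContinuousLinearMap.coe_coe] at h
    have h1 := parallelogram_law_with_norm ℂ x y
    have h2 := parallelogram_law_with_norm ℂ x (Complex.I • y)
    rw [norm_smul, Complex.norm_I, one_mul] at h2
    have e1 := hA' (x + y)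
    have e2 := hA' (x - y)
    have e3 := hA' (x + Complex.I • y)
    have e4 := hA' (x - Complex.I • y)
    rw [h, norm_div, show ‖(4 : ℂ)‖ = 4 by norm_num, div_le_iff₀ (by norm_num)]
    refine (norm_sub_le _ _).trans ?_
    refine (add_le_add_left ((norm_add_le _ _).trans
      (add_le_add_left (norm_sub_le _ _) _)) _).trans ?_
    simp only [norm_mul, Complex.norm_I, one_mul]
    calc _ ≤ C * ‖x + y‖ ^ 2 + C * ‖x - y‖ ^ 2 + C * ‖x + Complex.I • y‖ ^ 2
          + C * ‖x - Complex.I • y‖ ^ 2 := by linarith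
      _ = C * ((‖x + y‖ ^ 2 + ‖x - y‖ ^ 2) +
          (‖x + Complex.I • y‖ ^ 2 + ‖x - Complex.I • y‖ ^ 2)) := by ring
      _ = _ := by rw [h1, h2]; ring
  refine A.opNorm_le_bound (by positivity) fun y => ?_
  rcases eq_or_ne (A y) 0 with h0 | h0
  · rw [h0, norm_zero]; positivity
  have ha : 0 < ‖A y‖ := norm_pos_iff.2 h0
  have hy : 0 < ‖y‖ := norm_pos_iff.2 fun h => h0 (by rw [h, map_zero])
  have h := hpol (((‖y‖ / ‖A y‖ : ℝ) : ℂ) • A y) y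
  rw [inner_smul_right, inner_self_eq_norm_sq_to_K, norm_mul, norm_smul, Complex.norm_real,
    Real.norm_of_nonneg (by positivity)] at h
  rw [norm_pow, RCLike.norm_ofReal, abs_norm] at h
  have e1 : ‖y‖ / ‖A y‖ * ‖A y‖ ^ 2 = ‖y‖ * ‖A y‖ := by field_simp
  have e2 : ‖y‖ / ‖A y‖ * ‖A y‖ = ‖y‖ := by field_simp
  rw [e1, e2] at h
  nlinarith

lemma eq_of_inner_eq_on_dense {D : Set K} (hD : Dense D) {A B : K →L[ℂ] K}
    (h : ∀ k ∈ D, ∀ l ∈ D, ⟪k, A l⟫_ℂ = ⟪k, B l⟫_ℂ) : A = B := by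
  apply ContinuousLinearMap.coeFn_injective
  refine Continuous.ext_on hD A.continuous B.continuous fun l hl => ?_
  refine hD.eq_of_inner_right (𝕜 := ℂ) fun k hk => ?_
  exact h k hk l hl

lemma eq_of_inner_eq_on_span {G : Set K} (hG : Dense (Submodule.span ℂ G : Set K))
    {A B : K →L[ℂ] K} (h : ∀ k ∈ G, ∀ l ∈ G, ⟪k, A l⟫_ℂ = ⟪k, B l⟫_ℂ) : A = B := by
  refine eq_of_inner_eq_on_dense hG fun k hk l hl => ?_
  induction hk, hl using Submodule.span_induction₂ with
  | mem_mem k l hk hl => exact h k hk l hl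
  | zero_left l _ => simp
  | zero_right k _ => simp
  | add_left _ _ _ _ _ _ h₁ h₂ => rw [inner_add_left, inner_add_left, h₁, h₂]
  | add_right _ _ _ _ _ _ h₁ h₂ => rw [map_add, map_add, inner_add_right, inner_add_right, h₁, h₂]
  | smul_left a _ _ _ _ h => rw [inner_smul_left, inner_smul_left, h]
  | smul_right a _ _ _ _ h => rw [map_smul, map_smul, inner_smul_right, inner_smul_right, h]

end Operators

section SpectralDensity

variable {K : Type*} [NormedAddCommGroup K] [InnerProductSpace ℂ K]
variable {S : Type*} [MeasurableSpace S]

/-- `g` is a `ν`-density of `Δ ↦ ⟪k, P Δ l⟫` which also represents `f ↦ ⟪k, κ f l⟫` on bounded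
measurable functions. -/
structure IsSpectralDensity (P : Set S → (K →L[ℂ] K)) (κ : (S → ℂ) → (K →L[ℂ] K))
    (ν : Measure S) (k l : K) (g : S → ℂ) : Prop where
  integrable : Integrable g ν
  inner_set : ∀ Δ, MeasurableSet Δ → ⟪k, P Δ l⟫_ℂ = ∫ s in Δ, g s ∂ν
  inner_fun : ∀ f, IsBoundedMeasurable f → ⟪k, κ f l⟫_ℂ = ∫ s, f s * g s ∂ν

variable {P : Set S → (K →L[ℂ] K)} {κ : (S → ℂ) → (K →L[ℂ] K)} {ν : Measure S}
variable {k k₁ k₂ l l₁ l₂ : K} {g g₁ g₂ : S → ℂ}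

lemma IsSpectralDensity.add_left (h₁ : IsSpectralDensity P κ ν k₁ l g₁)
    (h₂ : IsSpectralDensity P κ ν k₂ l g₂) :
    IsSpectralDensity P κ ν (k₁ + k₂) l (fun s => g₁ s + g₂ s) where
  integrable := h₁.integrable.add h₂.integrable
  inner_set Δ hΔ := by
    rw [inner_add_left, h₁.inner_set Δ hΔ, h₂.inner_set Δ hΔ,
      integral_add h₁.integrable.integrableOn h₂.integrable.integrableOn]
  inner_fun f hf := by
    simp_rw [mul_add]
    rw [inner_add_left, h₁.inner_fun f hf, h₂.inner_fun f hf,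
      integral_add (hf.integrable_mul h₁.integrable) (hf.integrable_mul h₂.integrable)]

lemma IsSpectralDensity.add_right (h₁ : IsSpectralDensity P κ ν k l₁ g₁)
    (h₂ : IsSpectralDensity P κ ν k l₂ g₂) :
    IsSpectralDensity P κ ν k (l₁ + l₂) (fun s => g₁ s + g₂ s) where
  integrable := h₁.integrable.add h₂.integrable
  inner_set Δ hΔ := by
    rw [map_add, inner_add_right, h₁.inner_set Δ hΔ, h₂.inner_set Δ hΔ,
      integral_add h₁.integrable.integrableOn h₂.integrable.integrableOn]
  inner_fun f hf := by
    simp_rw [mul_add]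
    rw [map_add, inner_add_right, h₁.inner_fun f hf, h₂.inner_fun f hf,
      integral_add (hf.integrable_mul h₁.integrable) (hf.integrable_mul h₂.integrable)]

lemma IsSpectralDensity.smul_left (a : ℂ) (h : IsSpectralDensity P κ ν k l g) :
    IsSpectralDensity P κ ν (a • k) l (fun s => star a * g s) where
  integrable := h.integrable.const_mul _
  inner_set Δ hΔ := by
    rw [inner_smul_left, h.inner_set Δ hΔ, integral_const_mul]; rfl
  inner_fun f hf := by
    simp_rw [mul_left_comm (f _)]
    rw [inner_smul_left, h.inner_fun f hf, integral_const_mul]; rfl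

lemma IsSpectralDensity.smul_right (a : ℂ) (h : IsSpectralDensity P κ ν k l g) :
    IsSpectralDensity P κ ν k (a • l) (fun s => a * g s) where
  integrable := h.integrable.const_mul _
  inner_set Δ hΔ := by
    rw [map_smul, inner_smul_right, h.inner_set Δ hΔ, integral_const_mul]
  inner_fun f hf := by
    simp_rw [mul_left_comm (f _)]
    rw [map_smul, inner_smul_right, h.inner_fun f hf, integral_const_mul]

lemma exists_isSpectralDensity_of_mem_span {G : Set K}
    (hG : ∀ k ∈ G, ∀ l ∈ G, ∃ g, IsSpectralDensity P κ ν k l g)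
    (hk : k ∈ Submodule.span ℂ G) (hl : l ∈ Submodule.span ℂ G) :
    ∃ g, IsSpectralDensity P κ ν k l g := by
  induction hk, hl using Submodule.span_induction₂ with
  | mem_mem k l hk hl => exact hG k hk l hl
  | zero_left l _ => exact ⟨fun _ => 0, integrable_zero _ _ _, by simp, by simp⟩
  | zero_right k _ => exact ⟨fun _ => 0, integrable_zero _ _ _, by simp, by simp⟩
  | add_left _ _ _ _ _ _ h₁ h₂ =>
    obtain ⟨_, h₁⟩ := h₁
    obtain ⟨_, h₂⟩ := h₂
    exact ⟨_, h₁.add_left h₂⟩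
  | add_right _ _ _ _ _ _ h₁ h₂ =>
    obtain ⟨_, h₁⟩ := h₁
    obtain ⟨_, h₂⟩ := h₂
    exact ⟨_, h₁.add_right h₂⟩
  | smul_left a _ _ _ _ h =>
    obtain ⟨_, h⟩ := h
    exact ⟨_, h.smul_left a⟩
  | smul_right a _ _ _ _ h =>
    obtain ⟨_, h⟩ := h
    exact ⟨_, h.smul_right a⟩

section Linear

variable {D : Set K} (hD : Dense D)
  (hdens : ∀ k ∈ D, ∀ l ∈ D, ∃ g, IsSpectralDensity P κ ν k l g)

include hD hdens

lemma spectral_indicator (c : ℂ) {Δ : Set S} (hΔ : MeasurableSet Δ) :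
    κ (Δ.indicator fun _ => c) = c • P Δ := by
  refine eq_of_inner_eq_on_dense hD fun k hk l hl => ?_
  obtain ⟨g, hg⟩ := hdens k hk l hl
  rw [hg.inner_fun _ (isBoundedMeasurable_indicator hΔ c), smul_apply,
    inner_smul_right, hg.inner_set Δ hΔ, ← integral_const_mul, ← integral_indicator hΔ]
  congr 1 with s
  by_cases hs : s ∈ Δ <;> simp [hs]

lemma spectral_add {f₁ f₂ : S → ℂ} (hf₁ : IsBoundedMeasurable f₁)
    (hf₂ : IsBoundedMeasurable f₂) : κ (fun s => f₁ s + f₂ s) = κ f₁ + κ f₂ := by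
  refine eq_of_inner_eq_on_dense hD fun k hk l hl => ?_
  obtain ⟨g, hg⟩ := hdens k hk l hl
  rw [hg.inner_fun _ (hf₁.add hf₂), add_apply, inner_add_right,
    hg.inner_fun _ hf₁, hg.inner_fun _ hf₂,
    ← integral_add (hf₁.integrable_mul hg.integrable) (hf₂.integrable_mul hg.integrable)]
  simp_rw [add_mul]

lemma spectral_sub {f₁ f₂ : S → ℂ} (hf₁ : IsBoundedMeasurable f₁)
    (hf₂ : IsBoundedMeasurable f₂) : κ (fun s => f₁ s - f₂ s) = κ f₁ - κ f₂ := by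
  rw [eq_sub_iff_add_eq, ← spectral_add hD hdens (hf₁.sub hf₂) hf₂]
  simp

end Linear

end SpectralDensity

section ProjectionAlgebra

variable {K : Type*} [NormedAddCommGroup K] [InnerProductSpace ℂ K]
variable {S : Type*} [MeasurableSpace S] {P : Set S → (K →L[ℂ] K)}
variable (hidem : ∀ Δ, MeasurableSet Δ → IsIdempotentElem (P Δ))
  (hadd : ∀ Δ₁ Δ₂, MeasurableSet Δ₁ → MeasurableSet Δ₂ → Disjoint Δ₁ Δ₂ →
    P (Δ₁ ∪ Δ₂) = P Δ₁ + P Δ₂)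

include hidem hadd in
lemma projection_mul_eq_zero_of_disjoint {Δ₁ Δ₂ : Set S} (h₁ : MeasurableSet Δ₁)
    (h₂ : MeasurableSet Δ₂) (h : Disjoint Δ₁ Δ₂) : P Δ₁ * P Δ₂ = 0 := by
  have hU := hidem _ (h₁.union h₂)
  rw [hadd _ _ h₁ h₂ h] at hU
  have e₁ : P Δ₁ * P Δ₁ = P Δ₁ := hidem _ h₁
  have e₂ : P Δ₂ * P Δ₂ = P Δ₂ := hidem _ h₂
  have hanti : P Δ₁ * P Δ₂ + P Δ₂ * P Δ₁ = 0 := by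
    have hU' : (P Δ₁ + P Δ₂) * (P Δ₁ + P Δ₂) = P Δ₁ + P Δ₂ := hU
    rw [mul_add, add_mul, add_mul, e₁, e₂] at hU'
    have := sub_eq_zero.2 hU'
    rw [← this]; abel
  have hL : P Δ₁ * P Δ₂ + P Δ₁ * P Δ₂ * P Δ₁ = 0 := by
    have := congrArg (P Δ₁ * ·) hanti
    simpa only [mul_add, ← mul_assoc, e₁, mul_zero] using this
  have hR : P Δ₁ * P Δ₂ * P Δ₁ + P Δ₂ * P Δ₁ = 0 := by
    have := congrArg (· * P Δ₁) hanti
    simpa only [add_mul, mul_assoc, e₁, zero_mul] using this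
  have hcomm : P Δ₁ * P Δ₂ = P Δ₂ * P Δ₁ := by
    rw [eq_neg_of_add_eq_zero_left hL, ← eq_neg_of_add_eq_zero_right hR]
  rw [← hcomm, ← two_smul ℂ] at hanti
  exact (smul_eq_zero.1 hanti).resolve_left two_ne_zero

include hidem hadd in
lemma projection_mul_projection {Δ₁ Δ₂ : Set S} (h₁ : MeasurableSet Δ₁)
    (h₂ : MeasurableSet Δ₂) : P Δ₁ * P Δ₂ = P (Δ₁ ∩ Δ₂) := by
  have e₁ : P Δ₁ = P (Δ₁ ∩ Δ₂) + P (Δ₁ \ Δ₂) := by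
    rw [← hadd _ _ (h₁.inter h₂) (h₁.diff h₂) disjoint_inf_sdiff, inter_union_sdiff]
  have e₂ : P Δ₂ = P (Δ₁ ∩ Δ₂) + P (Δ₂ \ Δ₁) := by
    rw [← hadd _ _ (h₁.inter h₂) (h₂.diff h₁) (inter_comm Δ₂ Δ₁ ▸ disjoint_inf_sdiff),
      inter_comm, inter_union_sdiff]
  have hz : P (Δ₁ \ Δ₂) * P Δ₂ = 0 :=
    projection_mul_eq_zero_of_disjoint hidem hadd (h₁.diff h₂) h₂ disjoint_sdiff_left
  have hz' : P (Δ₁ ∩ Δ₂) * P (Δ₂ \ Δ₁) = 0 :=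
    projection_mul_eq_zero_of_disjoint hidem hadd (h₁.inter h₂) (h₂.diff h₁)
      (disjoint_sdiff_right.mono_left inter_subset_left)
  rw [e₁, add_mul, hz, add_zero, e₂, mul_add, hz', add_zero]
  exact hidem _ (h₁.inter h₂)

end ProjectionAlgebra

section SpectralCalculus

variable {K : Type*} [NormedAddCommGroup K] [InnerProductSpace ℂ K] [CompleteSpace K]
variable {S : Type*} [MeasurableSpace S]
variable {P : Set S → (K →L[ℂ] K)} {κ : (S → ℂ) → (K →L[ℂ] K)} {ν : Measure S}

lemma inner_projection_self {Q : K →L[ℂ] K} (hidem : IsIdempotentElem Q)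
    (hsa : IsSelfAdjoint Q) (k l : K) : ⟪k, Q l⟫_ℂ = ⟪Q k, Q l⟫_ℂ := by
  have h : Q (Q l) = Q l := congrArg (fun R : K →L[ℂ] K => R l) hidem
  rw [← ContinuousLinearMap.adjoint_inner_right, hsa.adjoint_eq, h]

lemma norm_projection_apply_le {Q : K →L[ℂ] K} (hidem : IsIdempotentElem Q)
    (hsa : IsSelfAdjoint Q) (k : K) : ‖Q k‖ ≤ ‖k‖ := by
  have h := norm_inner_le_norm (𝕜 := ℂ) k (Q k)
  rw [inner_projection_self hidem hsa, inner_self_eq_norm_sq_to_K, norm_pow,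
    RCLike.norm_ofReal, abs_norm] at h
  by_contra! hlt
  nlinarith [norm_nonneg k]

variable (hidem : ∀ Δ, MeasurableSet Δ → IsIdempotentElem (P Δ))
  (hsa : ∀ Δ, MeasurableSet Δ → IsSelfAdjoint (P Δ))

include hidem hsa in
/-- The diagonal of `κ f` is bounded by any uniform bound of `f`, since the corresponding
density is nonnegative. -/
lemma norm_inner_spectral_le {k : K} {g : S → ℂ} (hg : IsSpectralDensity P κ ν k k g)
    {f : S → ℂ} (hf : Measurable f) {C : ℝ} (hC0 : 0 ≤ C) (hC : ∀ s, ‖f s‖ ≤ C) :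
    ‖⟪k, κ f k⟫_ℂ‖ ≤ C * ‖k‖ ^ 2 := by
  have hval : ∀ Δ, MeasurableSet Δ → ∫ s in Δ, g s ∂ν = ((‖P Δ k‖ ^ 2 : ℝ) : ℂ) :=
    fun Δ hΔ => by
      rw [← hg.inner_set Δ hΔ, inner_projection_self (hidem Δ hΔ) (hsa Δ hΔ),
        inner_self_eq_norm_sq_to_K]
      simp
  have hre : ∀ Δ, MeasurableSet Δ → ∫ s in Δ, (g s).re ∂ν = ‖P Δ k‖ ^ 2 := fun Δ hΔ => by
    have h := integral_re (𝕜 := ℂ) (hg.integrable.integrableOn (s := Δ))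
    rw [hval Δ hΔ, RCLike.re_eq_complex_re, Complex.ofReal_re] at h
    exact h
  have hgre : Integrable (fun s => (g s).re) ν := hg.integrable.re
  have hreal : g =ᵐ[ν] fun s => ((g s).re : ℂ) :=
    hg.integrable.ae_eq_of_forall_setIntegral_eq _ _ hgre.ofReal fun Δ hΔ _ => by
      rw [hval Δ hΔ, integral_complex_ofReal, hre Δ hΔ]
  have hpos : 0 ≤ᵐ[ν] fun s => (g s).re :=
    ae_nonneg_of_forall_setIntegral_nonneg hgre fun Δ hΔ _ => by
      rw [hre Δ hΔ]; positivity
  rw [hg.inner_fun f ⟨hf, C, hC⟩]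
  have huniv : ∫ s, (g s).re ∂ν = ‖P univ k‖ ^ 2 := by
    rw [← hre univ .univ, setIntegral_univ]
  calc ‖∫ s, f s * g s ∂ν‖ ≤ ∫ s, C * (g s).re ∂ν := by
        refine norm_integral_le_of_norm_le (hgre.const_mul C) ?_
        filter_upwards [hreal, hpos] with s hs hs0
        rw [norm_mul]
        have : ‖g s‖ = (g s).re := by
          conv_lhs => rw [hs]
          rw [Complex.norm_real, Real.norm_of_nonneg hs0]
        rw [this]
        exact mul_le_mul_of_nonneg_right (hC s) hs0
    _ = C * ‖P univ k‖ ^ 2 := by rw [integral_const_mul, huniv]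
    _ ≤ C * ‖k‖ ^ 2 := by
        gcongr
        exact norm_projection_apply_le (hidem _ .univ) (hsa _ .univ) k

variable {D : Set K} (hD : Dense D)
  (hdens : ∀ k ∈ D, ∀ l ∈ D, ∃ g, IsSpectralDensity P κ ν k l g)

include hidem hsa hD hdens in
lemma norm_spectral_le {f : S → ℂ} (hf : Measurable f) {C : ℝ} (hC0 : 0 ≤ C)
    (hC : ∀ s, ‖f s‖ ≤ C) : ‖κ f‖ ≤ 2 * C := by
  refine opNorm_le_of_numericalRadius_le _ hC0 fun v => ?_
  have hclosed : IsClosed {v : K | ‖⟪v, κ f v⟫_ℂ‖ ≤ C * ‖v‖ ^ 2} :=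
    isClosed_le (by fun_prop) (by fun_prop)
  refine hclosed.closure_subset_iff.2 (fun k hk => ?_) (hD v)
  obtain ⟨g, hg⟩ := hdens k hk k hk
  exact norm_inner_spectral_le hidem hsa hg hf hC0 hC

include hidem hsa hD hdens

lemma spectral_star {f : S → ℂ} (hf : IsBoundedMeasurable f) :
    κ (fun s => star (f s)) = star (κ f) := by
  refine IsBoundedMeasurable.induction (p := fun f => κ (fun s => star (f s)) = star (κ f))
    (fun c Δ hΔ => ?_) (fun f₁ f₂ h₁ h₂ e₁ e₂ => ?_) (fun f hf hlim => ?_) hf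
  · have : (fun s => star (Δ.indicator (fun _ => c) s)) = Δ.indicator fun _ => star c := by
      ext s; by_cases hs : s ∈ Δ <;> simp [hs]
    rw [this, spectral_indicator hD hdens _ hΔ, spectral_indicator hD hdens _ hΔ, star_smul,
      (hsa Δ hΔ).star_eq]
  · simp_rw [star_add]
    rw [spectral_add hD hdens h₁.star h₂.star, spectral_add hD hdens h₁ h₂, e₁, e₂, star_add]
  · rw [← sub_eq_zero, ← norm_le_zero_iff]
    refine le_of_forall_pos_le_add fun δ hδ => ?_
    obtain ⟨g, hg, hgp, hfg⟩ := hlim (δ / 4) (by positivity)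
    have h₁ := norm_spectral_le hidem hsa hD hdens (hf.sub hg).1 (by positivity) hfg
    have h₂ := norm_spectral_le hidem hsa hD hdens (hf.star.sub hg.star).1
      (C := δ / 4) (by positivity) fun s => by rw [← star_sub, norm_star]; exact hfg s
    rw [spectral_sub hD hdens hf hg] at h₁
    rw [spectral_sub hD hdens hf.star hg.star] at h₂
    calc _ = ‖(κ (fun s => star (f s)) - κ (fun s => star (g s))) - star (κ f - κ g)‖ := by
          rw [hgp, star_sub]; congr 1; abel
      _ ≤ _ := (norm_sub_le _ _).trans (by rw [norm_star]; linarith)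

lemma spectral_mul_of_uniform_limit {f h : S → ℂ} (hf : IsBoundedMeasurable f)
    (hh : IsBoundedMeasurable h)
    (hlim : ∀ ε > 0, ∃ g, IsBoundedMeasurable g ∧ κ (fun s => g s * h s) = κ g * κ h ∧
      ∀ s, ‖f s - g s‖ ≤ ε) : κ (fun s => f s * h s) = κ f * κ h := by
  obtain ⟨B, hB⟩ := hh.2
  have hB' : ∀ s, ‖h s‖ ≤ |B| := fun s => (hB s).trans (le_abs_self B)
  have hκh := norm_spectral_le hidem hsa hD hdens hh.1 (abs_nonneg B) hB'
  rw [← sub_eq_zero, ← norm_le_zero_iff]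
  refine le_of_forall_pos_le_add fun δ hδ => ?_
  obtain ⟨g, hg, hgp, hfg⟩ := hlim (δ / (6 * (|B| + 1))) (by positivity)
  set ε := δ / (6 * (|B| + 1)) with hε
  have hε0 : 0 < ε := by positivity
  have hεδ : 6 * ((|B| + 1) * ε) = δ := by rw [hε]; field_simp
  have h₁ := norm_spectral_le hidem hsa hD hdens (hf.sub hg).1 hε0.le hfg
  have h₂ := norm_spectral_le hidem hsa hD hdens ((hf.mul hh).sub (hg.mul hh)).1
    (C := ε * |B|) (by positivity) fun s => by
      rw [← sub_mul, norm_mul]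
      exact mul_le_mul (hfg s) (hB' s) (norm_nonneg _) hε0.le
  rw [spectral_sub hD hdens hf hg] at h₁
  rw [spectral_sub hD hdens (hf.mul hh) (hg.mul hh)] at h₂
  have h₃ : ‖(κ f - κ g) * κ h‖ ≤ 2 * ε * (2 * |B|) :=
    (norm_mul_le _ _).trans (mul_le_mul h₁ hκh (norm_nonneg _) (by positivity))
  calc _ = ‖(κ (fun s => f s * h s) - κ (fun s => g s * h s)) - (κ f - κ g) * κ h‖ := by
        rw [hgp, sub_mul]; congr 1; abel
    _ ≤ _ := (norm_sub_le _ _).trans (by linarith)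

variable (hadd : ∀ Δ₁ Δ₂, MeasurableSet Δ₁ → MeasurableSet Δ₂ → Disjoint Δ₁ Δ₂ →
  P (Δ₁ ∪ Δ₂) = P Δ₁ + P Δ₂)

include hadd

lemma spectral_indicator_mul {f : S → ℂ} (hf : IsBoundedMeasurable f) (c : ℂ) {Δ : Set S}
    (hΔ : MeasurableSet Δ) :
    κ (fun s => f s * Δ.indicator (fun _ => c) s) = κ f * κ (Δ.indicator fun _ => c) := by
  have hi := isBoundedMeasurable_indicator hΔ c
  refine IsBoundedMeasurable.induction
    (p := fun f => κ (fun s => f s * Δ.indicator (fun _ => c) s) =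
      κ f * κ (Δ.indicator fun _ => c))
    (fun a Δ₁ hΔ₁ => ?_) (fun f₁ f₂ h₁ h₂ e₁ e₂ => ?_) (fun f hf hlim => ?_) hf
  · have : (fun s => Δ₁.indicator (fun _ => a) s * Δ.indicator (fun _ => c) s) =
        (Δ₁ ∩ Δ).indicator fun _ => a * c := by
      ext s; by_cases hs : s ∈ Δ <;> by_cases hs₁ : s ∈ Δ₁ <;> simp [hs, hs₁]
    rw [this, spectral_indicator hD hdens _ hΔ, spectral_indicator hD hdens _ hΔ₁,
      spectral_indicator hD hdens _ (hΔ₁.inter hΔ), smul_mul_smul_comm,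
      projection_mul_projection hidem hadd hΔ₁ hΔ]
  · simp_rw [add_mul]
    rw [spectral_add hD hdens (h₁.mul hi) (h₂.mul hi), spectral_add hD hdens h₁ h₂, e₁, e₂,
      add_mul]
  · exact spectral_mul_of_uniform_limit hidem hsa hD hdens hf hi hlim

lemma spectral_mul {f h : S → ℂ} (hf : IsBoundedMeasurable f) (hh : IsBoundedMeasurable h) :
    κ (fun s => f s * h s) = κ f * κ h := by
  refine IsBoundedMeasurable.induction (p := fun f => κ (fun s => f s * h s) = κ f * κ h)
    (fun a Δ hΔ => ?_) (fun f₁ f₂ h₁ h₂ e₁ e₂ => ?_) (fun f hf hlim => ?_) hf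
  · have hi := isBoundedMeasurable_indicator hΔ a
    have e := spectral_indicator_mul hidem hsa hD hdens hadd hh.star (star a) hΔ
    have e' := congrArg star e
    rw [star_mul, ← spectral_star hidem hsa hD hdens hh.star,
      ← spectral_star hidem hsa hD hdens (isBoundedMeasurable_indicator hΔ _),
      ← spectral_star hidem hsa hD hdens
        (hh.star.mul (isBoundedMeasurable_indicator hΔ _))] at e'
    have : (fun s => star (Δ.indicator (fun _ => star a) s)) = Δ.indicator fun _ => a := by
      ext s; by_cases hs : s ∈ Δ <;> simp [hs]
    simp only [star_mul, star_star] at e'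
    simpa only [congrFun this, this] using e'
  · simp_rw [add_mul]
    rw [spectral_add hD hdens (h₁.mul hh) (h₂.mul hh), spectral_add hD hdens h₁ h₂, e₁, e₂,
      add_mul]
  · exact spectral_mul_of_uniform_limit hidem hsa hD hdens hf hh hlim

end SpectralCalculus

section Density

variable {K : Type*} [NormedAddCommGroup K] [InnerProductSpace ℂ K] [CompleteSpace K]
variable {S : Type*} [MeasurableSpace S] {P : Set S → (K →L[ℂ] K)}
variable (hidem : ∀ Δ, MeasurableSet Δ → IsIdempotentElem (P Δ))
  (hsa : ∀ Δ, MeasurableSet Δ → IsSelfAdjoint (P Δ))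
  (hadd : ∀ Δ₁ Δ₂, MeasurableSet Δ₁ → MeasurableSet Δ₂ → Disjoint Δ₁ Δ₂ →
    P (Δ₁ ∪ Δ₂) = P Δ₁ + P Δ₂)

include hidem hsa hadd

lemma summable_norm_sq_projection {Δ : ℕ → Set S} (hΔ : ∀ i, MeasurableSet (Δ i))
    (hdisj : Pairwise (Function.onFun Disjoint Δ)) (k : K) :
    Summable fun i => ‖P (Δ i) k‖ ^ 2 := by
  have hempty : P ∅ = 0 := by simpa using hadd ∅ ∅ .empty .empty (disjoint_empty _)
  have hmeas : ∀ n, MeasurableSet (⋃ i ∈ Finset.range n, Δ i) := fun n =>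
    Finset.measurableSet_biUnion _ fun i _ => hΔ i
  have hsum : ∀ n, P (⋃ i ∈ Finset.range n, Δ i) = ∑ i ∈ Finset.range n, P (Δ i) := fun n => by
    induction n with
    | zero => simpa using hempty
    | succ n ih =>
      rw [Finset.sum_range_succ, ← ih, ← hadd _ _ (hmeas n) (hΔ n)]
      · rw [Finset.range_add_one, Finset.set_biUnion_insert, union_comm]
      · simp only [disjoint_iUnion_left, Finset.mem_range]
        exact fun i hi => hdisj hi.ne
  refine summable_of_sum_range_le (c := ‖k‖ ^ 2) (fun i => by positivity) fun n => ?_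
  have hsq : ∀ Δ, MeasurableSet Δ → ((‖P Δ k‖ ^ 2 : ℝ) : ℂ) = ⟪k, P Δ k⟫_ℂ := fun Δ hΔ => by
    rw [inner_projection_self (hidem Δ hΔ) (hsa Δ hΔ), inner_self_eq_norm_sq_to_K]
    simp
  have : ∑ i ∈ Finset.range n, ‖P (Δ i) k‖ ^ 2 =
      ‖P (⋃ i ∈ Finset.range n, Δ i) k‖ ^ 2 := by
    rw [← Complex.ofReal_inj, hsq _ (hmeas n), hsum, Complex.ofReal_sum, sum_apply, inner_sum]
    exact Finset.sum_congr rfl fun i _ => hsq _ (hΔ i)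
  rw [this]
  gcongr
  exact norm_projection_apply_le (hidem _ (hmeas n)) (hsa _ (hmeas n)) k

lemma summable_inner_projection {Δ : ℕ → Set S} (hΔ : ∀ i, MeasurableSet (Δ i))
    (hdisj : Pairwise (Function.onFun Disjoint Δ)) (k l : K) :
    Summable fun i => ⟪k, P (Δ i) l⟫_ℂ := by
  refine Summable.of_norm_bounded ((summable_norm_sq_projection hidem hsa hadd hΔ hdisj k).add
    (summable_norm_sq_projection hidem hsa hadd hΔ hdisj l)) fun i => ?_
  rw [inner_projection_self (hidem _ (hΔ i)) (hsa _ (hΔ i))]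
  have := norm_inner_le_norm (𝕜 := ℂ) (P (Δ i) k) (P (Δ i) l)
  nlinarith [sq_nonneg (‖P (Δ i) k‖ - ‖P (Δ i) l‖), sq_nonneg (‖P (Δ i) k‖),
    sq_nonneg (‖P (Δ i) l‖)]

/-- A weakly countably additive projection-valued set function dominated by a finite measure
has densities. -/
lemma exists_density_inner_projection (ν : Measure S) [IsFiniteMeasure ν]
    (hν : ∀ Δ, MeasurableSet Δ → ν Δ = 0 → P Δ = 0) (k l : K)
    (hsum : ∀ Δ : ℕ → Set S, (∀ i, MeasurableSet (Δ i)) →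
      Pairwise (Function.onFun Disjoint Δ) →
      ⟪k, P (⋃ i, Δ i) l⟫_ℂ = ∑' i, ⟪k, P (Δ i) l⟫_ℂ) :
    ∃ g : S → ℂ, Integrable g ν ∧
      ∀ Δ, MeasurableSet Δ → ⟪k, P Δ l⟫_ℂ = ∫ s in Δ, g s ∂ν := by
  classical
  let c : ComplexMeasure S :=
    { measureOf' := fun Δ => if MeasurableSet Δ then ⟪k, P Δ l⟫_ℂ else 0
      empty' := by
        have : P ∅ = 0 := by simpa using hadd ∅ ∅ .empty .empty (disjoint_empty _)
        simp [this]
      not_measurable' := fun Δ hΔ => if_neg hΔ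
      m_iUnion' := fun Δ hΔ hdisj => by
        simp only [hΔ, if_true, MeasurableSet.iUnion hΔ]
        rw [hsum Δ hΔ hdisj]
        exact (summable_inner_projection hidem hsa hadd hΔ hdisj k l).hasSum }
  have hc : ∀ Δ, MeasurableSet Δ → c Δ = ⟪k, P Δ l⟫_ℂ := fun Δ hΔ => if_pos hΔ
  obtain ⟨g, hg, hgc⟩ := exists_density_of_absolutelyContinuous ν c fun Δ hΔ h => by
    rw [hc Δ hΔ, hν Δ hΔ h]; simp
  exact ⟨g, hg, fun Δ hΔ => by rw [← hc Δ hΔ, hgc Δ hΔ]⟩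

end Density

section CPMeasureAdditivity

variable {X : Type*} [NormedRing X] [StarRing X] [NormedAlgebra ℂ X]
variable {H : Type*} [NormedAddCommGroup H] [InnerProductSpace ℂ H] [CompleteSpace H]
variable {S : Type*} [MeasurableSpace S]
variable {M : VonNeumannAlgebra H} {μ : Set S → X → (H →L[ℂ] H)}

lemma IsCPMeasure.inner_empty (hμ : IsCPMeasure M μ) (x : X) (ξ η : H) :
    ⟪ξ, μ ∅ x η⟫_ℂ = 0 := by
  have h := hμ.2 (fun _ => ∅) (fun _ => .empty) (fun _ _ _ => disjoint_empty _) x ξ η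
  rw [iUnion_empty, tsum_const] at h
  simpa using h

lemma IsCPMeasure.inner_union (hμ : IsCPMeasure M μ) {Δ₁ Δ₂ : Set S} (h₁ : MeasurableSet Δ₁)
    (h₂ : MeasurableSet Δ₂) (h : Disjoint Δ₁ Δ₂) (x : X) (ξ η : H) :
    ⟪ξ, μ (Δ₁ ∪ Δ₂) x η⟫_ℂ = ⟪ξ, μ Δ₁ x η⟫_ℂ + ⟪ξ, μ Δ₂ x η⟫_ℂ := by
  let Δ : ℕ → Set S := fun i => if i = 0 then Δ₁ else if i = 1 then Δ₂ else ∅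
  have hΔ : ∀ i, MeasurableSet (Δ i) := fun i => by
    simp only [Δ]; split_ifs <;> simp [h₁, h₂]
  have hdisj : Pairwise (Function.onFun Disjoint Δ) := fun i j hij => by
    simp only [Function.onFun, Δ]
    split_ifs <;> first | omega | simp [h.symm]
  have hU : ⋃ i, Δ i = Δ₁ ∪ Δ₂ := by
    ext s
    simp only [mem_iUnion, mem_union]
    constructor
    · rintro ⟨i, hi⟩
      simp only [Δ] at hi
      split_ifs at hi
      · exact .inl hi
      · exact .inr hi
      · exact hi.elim
    · rintro (hs | hs)
      · exact ⟨0, by simpa [Δ] using hs⟩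
      · exact ⟨1, by simpa [Δ] using hs⟩
  have hs := hμ.2 Δ hΔ hdisj x ξ η
  rw [hU, tsum_eq_sum (s := Finset.range 2) fun i hi => by
    rw [Finset.mem_range] at hi
    have : Δ i = ∅ := by
      simp only [Δ]; rw [if_neg (by omega), if_neg (by omega)]
    rw [this, hμ.inner_empty]] at hs
  simpa [Finset.sum_range_succ, Δ] using hs

end CPMeasureAdditivity

section Stinespring

variable {X : Type*} [NormedRing X] [StarRing X] [NormedAlgebra ℂ X]
variable {H K : Type*} [NormedAddCommGroup H] [InnerProductSpace ℂ H] [CompleteSpace H]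
  [NormedAddCommGroup K] [InnerProductSpace ℂ K] [CompleteSpace K]
  {π : X →⋆ₐ[ℂ] (K →L[ℂ] K)} {V : H →L[ℂ] K}

/-- Matrix coefficients of an operator in the commutant of `π`, between generating vectors. -/
lemma inner_commutant {R : K →L[ℂ] K} (hR : ∀ x, R * π x = π x * R) (y x : X) (ξ η : H) :
    ⟪π y (V ξ), R (π x (V η))⟫_ℂ =
      ⟪ξ, ((ContinuousLinearMap.adjoint V).comp (R.comp ((π (star y * x)).comp V))) η⟫_ℂ := by
  have h : R (π (star y) (π x (V η))) = π (star y) (R (π x (V η))) :=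
    congrArg (fun A : K →L[ℂ] K => A (π x (V η))) (hR (star y))
  simp only [ContinuousLinearMap.comp_apply]
  rw [ContinuousLinearMap.adjoint_inner_right, map_mul, mul_apply_eq_comp, h,
    map_star, ContinuousLinearMap.star_eq_adjoint, ContinuousLinearMap.adjoint_inner_right]

lemma IsMinimalStinespring.dense [CStarRing X] [StarModule ℂ X]
    (hmin : IsMinimalStinespring π V) :
    Dense (Submodule.span ℂ {k : K | ∃ (x : X) (h : H), k = π x (V h)} : Set K) :=
  Submodule.dense_iff_topologicalClosure_eq_top.2 hmin

end Stinespring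

end

/-- If `(S, F, μ)` is an orthogonal CP-measure space with barycenter `T` (for every
measurable `Δ`, `μ(Δ)` and `μ(Δᶜ)` are implemented by complementary projections in
`π_T(X)′`), then `κ_μ` is a *-homomorphism:
`κ_μ(f g) = κ_μ(f) κ_μ(g)` and `κ_μ(f̄) = κ_μ(f)*`. -/
theorem kappa_star_hom_of_orthogonal
    {X : Type*} [NormedRing X] [StarRing X] [CStarRing X]
    [NormedAlgebra ℂ X] [StarModule ℂ X]
    {H K : Type*} [NormedAddCommGroup H] [InnerProductSpace ℂ H] [CompleteSpace H]
    [NormedAddCommGroup K] [InnerProductSpace ℂ K] [CompleteSpace K]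
    {S : Type*} [MeasurableSpace S]
    (M : VonNeumannAlgebra H) (μ : Set S → X → (H →L[ℂ] H))
    (hμ : IsCPMeasure M μ)
    (e : ℕ → H) (hρ : IsNormalFaithfulStateOn M e)
    (ν : MeasureTheory.Measure S) [MeasureTheory.IsFiniteMeasure ν]
    (hν : IsEquivalentBaseMeasure μ e ν)
    (π : X →⋆ₐ[ℂ] (K →L[ℂ] K)) (V : H →L[ℂ] K)
    (hst : IsStinespring (μ Set.univ) π V) (hmin : IsMinimalStinespring π V)
    (horth : ∀ Δ : Set S, MeasurableSet Δ →
      ∃ P : K →L[ℂ] K, IsIdempotentElem P ∧ IsSelfAdjoint P ∧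
        (∀ x : X, P * π x = π x * P) ∧
        (∀ x : X, μ Δ x =
          (ContinuousLinearMap.adjoint V).comp (P.comp ((π x).comp V))) ∧
        (∀ x : X, μ Δᶜ x =
          (ContinuousLinearMap.adjoint V).comp ((1 - P).comp ((π x).comp V))))
    (κ : (S → ℂ) → (K →L[ℂ] K))
    (hκ : ∀ f : S → ℂ, Measurable f → (∃ C : ℝ, ∀ s, ‖f s‖ ≤ C) →
      (∀ x : X, κ f * π x = π x * κ f) ∧ IsKappa μ ν π V f (κ f)) :
    ∀ f g : S → ℂ, Measurable f → (∃ C : ℝ, ∀ s, ‖f s‖ ≤ C) →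
      Measurable g → (∃ C : ℝ, ∀ s, ‖g s‖ ≤ C) →
      κ (fun s => f s * g s) = κ f * κ g ∧
      κ (fun s => star (f s)) = ContinuousLinearMap.adjoint (κ f) := by
  choose! P hidem hsa hcomm hPμ _ using horth
  have hD := hmin.dense
  have hcoef : ∀ Δ, MeasurableSet Δ → ∀ (y x : X) (ξ η : H),
      ⟪π y (V ξ), P Δ (π x (V η))⟫_ℂ = ⟪ξ, μ Δ (star y * x) η⟫_ℂ := fun Δ hΔ y x ξ η => by
    rw [inner_commutant (hcomm Δ hΔ), hPμ Δ hΔ]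
  have hadd : ∀ Δ₁ Δ₂, MeasurableSet Δ₁ → MeasurableSet Δ₂ → Disjoint Δ₁ Δ₂ →
      P (Δ₁ ∪ Δ₂) = P Δ₁ + P Δ₂ := fun Δ₁ Δ₂ h₁ h₂ h => by
    refine eq_of_inner_eq_on_span hD ?_
    rintro _ ⟨y, ξ, rfl⟩ _ ⟨x, η, rfl⟩
    rw [add_apply, inner_add_right, hcoef _ (h₁.union h₂), hcoef _ h₁, hcoef _ h₂,
      hμ.inner_union h₁ h₂ h]
  have hac : ∀ Δ, MeasurableSet Δ → ν Δ = 0 → P Δ = 0 := fun Δ hΔ h => by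
    have hform : μ Δ 1 = (ContinuousLinearMap.adjoint V).comp ((P Δ).comp V) := by
      rw [hPμ Δ hΔ, map_one]; rfl
    have hpos : (μ Δ 1).IsPositive := by
      rw [hform]
      exact (ContinuousLinearMap.IsPositive.of_isStarProjection
        ⟨hidem Δ hΔ, hsa Δ hΔ⟩).adjoint_conj V
    have hzero : μ Δ 1 = 0 := hρ.2 _ ((hμ.1 Δ hΔ).2.2 1) hpos ((hν Δ hΔ).1 h)
    have hPV : ∀ η, P Δ (V η) = 0 := fun η => by
      have hin : ⟪η, μ Δ 1 η⟫_ℂ = ⟪V η, P Δ (V η)⟫_ℂ := by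
        rw [hform]
        exact ContinuousLinearMap.adjoint_inner_right V _ _
      rw [hzero, inner_projection_self (hidem Δ hΔ) (hsa Δ hΔ)] at hin
      exact inner_self_eq_zero.1 (hin.symm.trans (by simp))
    refine eq_of_inner_eq_on_span hD ?_
    rintro k - _ ⟨x, η, rfl⟩
    have hx : P Δ (π x (V η)) = π x (P Δ (V η)) :=
      congrArg (fun A : K →L[ℂ] K => A (V η)) (hcomm Δ hΔ x)
    rw [hx, hPV, map_zero]
    simp
  have hgen : ∀ k ∈ {k : K | ∃ (x : X) (h : H), k = π x (V h)},
      ∀ l ∈ {k : K | ∃ (x : X) (h : H), k = π x (V h)},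
      ∃ g, IsSpectralDensity P κ ν k l g := by
    rintro _ ⟨y, ξ, rfl⟩ _ ⟨x, η, rfl⟩
    obtain ⟨g, hg, hgP⟩ := exists_density_inner_projection hidem hsa hadd ν hac
      (π y (V ξ)) (π x (V η)) fun Δ hΔ hdisj => by
        rw [hcoef _ (MeasurableSet.iUnion hΔ), hμ.2 Δ hΔ hdisj]
        exact tsum_congr fun i => (hcoef _ (hΔ i) y x ξ η).symm
    refine ⟨g, hg, hgP, fun f hf => ?_⟩
    obtain ⟨hfcomm, hfκ⟩ := hκ f hf.1 hf.2
    rw [inner_commutant hfcomm]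
    exact hfκ _ ξ η g hg fun Δ hΔ => by rw [← hcoef Δ hΔ, hgP Δ hΔ]
  have hdens : ∀ k ∈ (Submodule.span ℂ {k : K | ∃ (x : X) (h : H), k = π x (V h)} : Set K),
      ∀ l ∈ (Submodule.span ℂ {k : K | ∃ (x : X) (h : H), k = π x (V h)} : Set K),
      ∃ g, IsSpectralDensity P κ ν k l g :=
    fun k hk l hl => exists_isSpectralDensity_of_mem_span hgen hk hl
  intro f g hf hfb hg hgb
  exact ⟨spectral_mul hidem hsa hD hdens hadd ⟨hf, hfb⟩ ⟨hg, hgb⟩,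
    spectral_star hidem hsa hD hdens ⟨hf, hfb⟩⟩
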